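/- The series D = Σ_{n≥0} d_n u^{−2n} y^{3n} satisfies the differential equation Ŝ_y D = y^{−1} · A(−y) as an identity of formal Laurent series in y over K, where A(−y) := Σ_{n≥0} (−1)^n a_n u^{−2n} y^{3n}. -/

import Mathlib

noncomputable section

/-- The base field `K = ℂ(u)`, rational functions in the variable `u`. -/
abbrev K : Type := RatFunc ℂ

/-- The variable `u ∈ K`. -/
def u : K := RatFunc.X

/-- The formal derivative `∂_y` of a formal Laurent series in `y` over `K`. -/
def derivLS (f : LaurentSeries K) : LaurentSeries K where
  coeff := fun n => ((n + 1 : ℤ) : K) * f.coeff (n + 1)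
  isPWO_support' := by
    refine ((f.isPWO_support.add (Set.isPWO_singleton (-1 : ℤ))).mono ?_)
    intro n hn
    simp only [Function.mem_support, ne_eq] at hn
    have hf : f.coeff (n + 1) ≠ 0 := fun h => hn (by simp [h])
    rw [Set.add_singleton]
    exact ⟨n + 1, by simpa [HahnSeries.mem_support] using hf, by ring⟩

/-- Multiplication of a formal Laurent series by `y^k`. -/
def ySh (k : ℤ) (f : LaurentSeries K) : LaurentSeries K :=
  (HahnSeries.single k (1 : K)) * f

/-- The operator `S_y f = u⁻² y³ ∂_y f + (1/2) u⁻² y² f + y⁻¹ f`. -/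
def Sy (f : LaurentSeries K) : LaurentSeries K :=
  (u⁻¹ ^ 2) • ySh 3 (derivLS f) + ((1 / 2 : K) * u⁻¹ ^ 2) • ySh 2 f + ySh (-1) f

/-- `a_n = (-1)^n (6n)! / (288^n (2n)! (3n)!)`. -/
def aQ (n : ℕ) : ℚ :=
  (-1) ^ n * ((6 * n).factorial : ℚ) /
    (288 ^ n * ((2 * n).factorial : ℚ) * ((3 * n).factorial : ℚ))

/-- The power-series-in-`y` `Σ_{n ≥ 0} c_n u^{-2n} y^{3n}` (viewed as a Laurent series)
attached to rational coefficients `c : ℕ → ℚ`. -/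
def mkS (c : ℕ → ℚ) : LaurentSeries K :=
  HahnSeries.ofPowerSeries ℤ K
    (PowerSeries.mk fun m => if 3 ∣ m then ((c (m / 3) : ℚ) : K) * u⁻¹ ^ (2 * (m / 3)) else 0)

/-- The series `A = Σ_{n ≥ 0} a_n u^{-2n} y^{3n}`. -/
def A : LaurentSeries K := mkS aQ

/-- The operator `Ŝ_y f = -u⁻² y³ ∂_y f - (3/2) u⁻² y² f + y⁻¹ f`. -/
def SyHat (f : LaurentSeries K) : LaurentSeries K :=
  -((u⁻¹ ^ 2) • ySh 3 (derivLS f)) - ((3 / 2 : K) * u⁻¹ ^ 2) • ySh 2 f + ySh (-1) f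

/-- `d_n = Σ_{i=0}^n 3^i |a_{n-i}| ∏_{k=1}^i (n + 1/2 - k)`. -/
def dQ (n : ℕ) : ℚ :=
  ∑ i ∈ Finset.range (n + 1),
    3 ^ i * |aQ (n - i)| * ∏ k ∈ Finset.Icc 1 i, ((n : ℚ) + 1 / 2 - (k : ℚ))

/-- The series `D = Σ_{n≥0} d_n u^{-2n} y^{3n}`. -/
def D : LaurentSeries K := mkS dQ

/-- `A(-y) = Σ_{n≥0} (-1)^n a_n u^{-2n} y^{3n}`. -/
def Aneg : LaurentSeries K := mkS fun n => (-1) ^ n * aQ n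

theorem coeff_ySh (k n : ℤ) (f : LaurentSeries K) :
    (ySh k f).coeff n = f.coeff (n - k) := by
  have h := HahnSeries.coeff_single_mul_add (r := (1 : K)) (x := f) (a := n - k) (b := k)
  rwa [sub_add_cancel, one_mul] at h

theorem coeff_derivLS (f : LaurentSeries K) (n : ℤ) :
    (derivLS f).coeff n = ((n + 1 : ℤ) : K) * f.coeff (n + 1) :=
  rfl

theorem coeff_mkS_natCast (c : ℕ → ℚ) (m : ℕ) :
    (mkS c).coeff (m : ℤ) =
      if 3 ∣ m then ((c (m / 3) : ℚ) : K) * u⁻¹ ^ (2 * (m / 3)) else 0 := by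
  rw [mkS, HahnSeries.ofPowerSeries_apply_coeff, PowerSeries.coeff_mk]

theorem coeff_mkS_three_mul (c : ℕ → ℚ) (m : ℕ) :
    (mkS c).coeff (3 * m : ℤ) = ((c m : ℚ) : K) * u⁻¹ ^ (2 * m) := by
  have h := coeff_mkS_natCast c (3 * m)
  rw [if_pos (dvd_mul_right 3 m), Nat.mul_div_cancel_left m three_pos] at h
  exact_mod_cast h

theorem coeff_mkS_of_neg (c : ℕ → ℚ) {n : ℤ} (hn : n < 0) : (mkS c).coeff n = 0 := by
  rw [mkS, HahnSeries.ofPowerSeries_apply]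
  refine HahnSeries.embDomain_of_notMem_range ?_
  rintro ⟨m, rfl⟩
  exact absurd hn (by simp)

theorem coeff_mkS_of_not_dvd (c : ℕ → ℚ) {n : ℤ} (hn : ¬ (3 : ℤ) ∣ n) :
    (mkS c).coeff n = 0 := by
  rcases lt_or_ge n 0 with h | h
  · exact coeff_mkS_of_neg c h
  · lift n to ℕ using h
    rw [coeff_mkS_natCast, if_neg (by omega)]

theorem abs_aQ (n : ℕ) : |aQ n| = (-1) ^ n * aQ n := by
  have h : (0 : ℚ) ≤ ((6 * n).factorial : ℚ) /
      (288 ^ n * ((2 * n).factorial : ℚ) * ((3 * n).factorial : ℚ)) := by positivity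
  rw [aQ, mul_div_assoc, abs_mul, abs_of_nonneg h, abs_pow, abs_neg, abs_one, one_pow,
    ← mul_assoc, ← mul_pow]
  norm_num

theorem dQ_zero : dQ 0 = |aQ 0| := by
  simp [dQ]

theorem dQ_succ (m : ℕ) :
    dQ (m + 1) = |aQ (m + 1)| + (3 * (m : ℚ) + 3 / 2) * dQ m := by
  rw [dQ, Finset.sum_range_succ', dQ, Finset.mul_sum, add_comm]
  congr 1
  · simp
  · refine Finset.sum_congr rfl fun i _ => ?_
    have hprod : ∏ k ∈ Finset.Icc 1 (i + 1), (((m + 1 : ℕ) : ℚ) + 1 / 2 - (k : ℚ)) =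
        ((m : ℚ) + 1 / 2) * ∏ k ∈ Finset.Icc 1 i, ((m : ℚ) + 1 / 2 - (k : ℚ)) := by
      simp only [← Finset.Ico_add_one_right_eq_Icc]
      rw [Finset.prod_eq_prod_Ico_succ_bot (by omega), ← Finset.prod_Ico_add' _ 1 (i + 1) 1]
      congr 1
      · push_cast; ring
      · refine Finset.prod_congr rfl fun k _ => ?_
        push_cast; ring
    rw [hprod, Nat.add_sub_add_right]
    ring

/-- The series `D` satisfies `Ŝ_y D = y⁻¹ · A(-y)`. -/
theorem stmt2 : SyHat D = ySh (-1) Aneg := by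
  ext n
  obtain ⟨N, rfl⟩ : ∃ N : ℤ, n = N - 1 := ⟨n + 1, by ring⟩
  simp only [SyHat, HahnSeries.coeff_add, HahnSeries.coeff_sub, HahnSeries.coeff_neg,
    HahnSeries.coeff_smul, coeff_ySh, coeff_derivLS, smul_eq_mul, D, Aneg]
  rw [show N - 1 - 3 + 1 = N - 3 by ring, show N - 1 - 2 = N - 3 by ring,
    show N - 1 - -1 = N by ring]
  by_cases hN : (3 : ℤ) ∣ N
  · obtain ⟨m, rfl⟩ := hN
    rcases lt_or_ge m 0 with hm | hm
    · simp [coeff_mkS_of_neg _ (show 3 * m < 0 by omega),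
        coeff_mkS_of_neg _ (show 3 * m - 3 < 0 by omega)]
    lift m to ℕ using hm
    rw [coeff_mkS_three_mul, coeff_mkS_three_mul, ← abs_aQ]
    cases m with
    | zero =>
      rw [coeff_mkS_of_neg _ (by simp), dQ_zero]
      ring
    | succ m =>
      rw [show 3 * ((m + 1 : ℕ) : ℤ) - 3 = 3 * m by push_cast; ring, coeff_mkS_three_mul, dQ_succ]
      push_cast
      ring
  · rw [coeff_mkS_of_not_dvd _ hN, coeff_mkS_of_not_dvd _ hN,
      coeff_mkS_of_not_dvd _ (show ¬ (3 : ℤ) ∣ N - 3 by omega)]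
    ring

end
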